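/- Let N = 3, a, b > 0, g : ℝ → ℝ, and suppose v ∈ C²(ℝ³) with ∫_{ℝ³}|∇v|² < ∞ satisfies −Δv = g(v) on ℝ³. Then there exists u ∈ C²(ℝ³) with ∫_{ℝ³}|∇u|² < ∞ satisfying the Kirchhoff equation −(a + b∫_{ℝ³}|∇u|²)·Δu = g(u) on ℝ³; namely u = v(t·) for the unique t > 0 with a·t² + b·t·∫_{ℝ³}|∇v|² = 1. -/

import Mathlib

open MeasureTheory

/-- The Laplacian of `u : ℝ^N → ℝ`, as the sum of second partial derivatives
along the standard basis directions. -/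
noncomputable def lap {N : ℕ} (u : EuclideanSpace ℝ (Fin N) → ℝ)
    (x : EuclideanSpace ℝ (Fin N)) : ℝ :=
  ∑ i : Fin N,
    fderiv ℝ (fun y => fderiv ℝ u y (EuclideanSpace.single i 1)) x (EuclideanSpace.single i 1)

/-- The Dirichlet energy `∫_{ℝ^N} |∇u|²`. -/
noncomputable def dirichlet {N : ℕ} (u : EuclideanSpace ℝ (Fin N) → ℝ) : ℝ :=
  ∫ x, ‖gradient u x‖ ^ 2

/-- The quadratic `a t² + c t = 1` with `a > 0` has a positive root. -/
theorem exists_pos_quadratic_eq_one {a : ℝ} (ha : 0 < a) (c : ℝ) :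
    ∃ t : ℝ, 0 < t ∧ a * t ^ 2 + c * t = 1 := by
  obtain ⟨r, hlt, hsq⟩ : ∃ r : ℝ, c < r ∧ r ^ 2 = c ^ 2 + 4 * a :=
    ⟨√(c ^ 2 + 4 * a), Real.lt_sqrt_of_sq_lt (by linarith), Real.sq_sqrt (by positivity)⟩
  refine ⟨(r - c) / (2 * a), div_pos (by linarith) (by positivity), ?_⟩
  field_simp
  linear_combination hsq

theorem dirichlet_nonneg {N : ℕ} (u : EuclideanSpace ℝ (Fin N) → ℝ) : 0 ≤ dirichlet u :=
  integral_nonneg fun _ => by positivity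

theorem norm_gradient_comp_smul_sq {N : ℕ} (u : EuclideanSpace ℝ (Fin N) → ℝ) (t : ℝ)
    (x : EuclideanSpace ℝ (Fin N)) :
    ‖gradient (fun y => u (t • y)) x‖ ^ 2 = t ^ 2 * ‖gradient u (t • x)‖ ^ 2 := by
  simp only [gradient, LinearIsometryEquiv.norm_map, fderiv_comp_smul, norm_smul, mul_pow,
    Real.norm_eq_abs, sq_abs]

theorem lap_comp_smul {N : ℕ} (u : EuclideanSpace ℝ (Fin N) → ℝ) (t : ℝ)
    (x : EuclideanSpace ℝ (Fin N)) :
    lap (fun y => u (t • y)) x = t ^ 2 * lap u (t • x) := by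
  unfold lap
  rw [Finset.mul_sum]
  refine Finset.sum_congr rfl fun i _ => ?_
  have h : (fun y => fderiv ℝ (fun z => u (t • z)) y (EuclideanSpace.single i 1)) =
      t • fun y => (fun z => fderiv ℝ u z (EuclideanSpace.single i 1)) (t • y) := by
    ext y
    simp [fderiv_comp_smul]
  rw [h, fderiv_const_smul_field, Pi.smul_apply,
    fderiv_comp_smul (f := fun z => fderiv ℝ u z (EuclideanSpace.single i 1))]
  simp only [smul_apply, smul_eq_mul]
  ring

theorem dirichlet_comp_smul {u : EuclideanSpace ℝ (Fin 3) → ℝ} {t : ℝ} (ht : 0 < t) :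
    dirichlet (fun y => u (t • y)) = t⁻¹ * dirichlet u := by
  unfold dirichlet
  simp_rw [norm_gradient_comp_smul_sq]
  rw [integral_const_mul,
    Measure.integral_comp_smul_of_nonneg volume (fun x => ‖gradient u x‖ ^ 2) t (hR := ht.le),
    finrank_euclideanSpace_fin, smul_eq_mul]
  field_simp

theorem stmt10 (a b : ℝ) (ha : 0 < a) (hb : 0 < b) (g : ℝ → ℝ)
    (v : EuclideanSpace ℝ (Fin 3) → ℝ)
    (hv : ContDiff ℝ 2 v)
    (hvInt : Integrable (fun x => ‖gradient v x‖ ^ 2))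
    (hvEq : ∀ x, -lap v x = g (v x)) :
    ∃ t : ℝ, 0 < t ∧ a * t ^ 2 + b * t * dirichlet v = 1 ∧
      (∀ s : ℝ, 0 < s → a * s ^ 2 + b * s * dirichlet v = 1 → s = t) ∧
      ContDiff ℝ 2 (fun x => v (t • x)) ∧
      Integrable (fun x => ‖gradient (fun y => v (t • y)) x‖ ^ 2) ∧
      ∀ x, -((a + b * dirichlet (fun y => v (t • y))) * lap (fun y => v (t • y)) x)
          = g (v (t • x)) := by
  have hD := dirichlet_nonneg v
  obtain ⟨t, ht, hroot⟩ := exists_pos_quadratic_eq_one ha (b * dirichlet v)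
  refine ⟨t, ht, by linear_combination hroot, fun s hs hsroot => ?_, by fun_prop, ?_, fun x => ?_⟩
  · have hpos : 0 < a * (s + t) + b * dirichlet v := by positivity
    refine sub_eq_zero.mp ((mul_eq_zero.mp ?_).resolve_right hpos.ne')
    linear_combination hsroot - hroot
  · simp_rw [norm_gradient_comp_smul_sq]
    exact (hvInt.comp_smul ht.ne').const_mul _
  · rw [dirichlet_comp_smul ht, lap_comp_smul, ← hvEq]
    field_simp
    linear_combination (-lap v (t • x)) * hroot
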